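/- Let T be a mixed tableau that is α-column-strict, β-row-strict, and (α,β)-sorted, and apply switches to T until it is fully switched. Then the resulting tableau is α-column-strict, β-row-strict, and (β,α)-sorted, and it is independent of the sequence of switches that produced it. -/

import Mathlib

/-!
Common definitions: mixed tableaux, tableau switching, shuffling, GG-jdt,
hook-valued tableaux and the uncrowding algorithms.
Conventions: French notation, cells `(i, j)` with `i` the row index (counted
from the bottom) and `j` the column index, both `≥ 1`.
-/

open scoped Classical

abbrev Cell : Type := ℕ × ℕ

/-- The cell directly above `c`. -/
def upCell (c : Cell) : Cell := (c.1 + 1, c.2)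

/-- The cell directly to the right of `c`. -/
def rtCell (c : Cell) : Cell := (c.1, c.2 + 1)

/-- A (finite) partition shape: a finite lower-order ideal of cells in the
positive quadrant (1-indexed, French notation). -/
def IsPartitionShape (s : Set Cell) : Prop :=
  s.Finite ∧ (∀ c ∈ s, 1 ≤ c.1 ∧ 1 ≤ c.2) ∧
    ∀ i j i' j' : ℕ, (i, j) ∈ s → 1 ≤ i' → i' ≤ i → 1 ≤ j' → j' ≤ j → (i', j') ∈ s

/-- Entries of mixed tableaux: `al k` represents `α_k`, `be k` represents `β_k`. -/
inductive MEntry : Type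
  | al (k : ℤ)
  | be (k : ℤ)
  deriving DecidableEq

/-- The index of a mixed entry. -/
def MEntry.idx : MEntry → ℤ
  | .al k => k
  | .be k => k

def MEntry.isAlpha : MEntry → Prop
  | .al _ => True
  | .be _ => False

def MEntry.isBeta : MEntry → Prop
  | .al _ => False
  | .be _ => True

/-- A mixed tableau: a partial filling of cells with mixed entries. -/
abbrev MixedTableau : Type := Cell → Option MEntry

/-- The set of cells filled in a mixed tableau. -/
def mshape (T : MixedTableau) : Set Cell := {c | T c ≠ none}

/-- A legal mixed tableau: finitely many cells, all in the positive quadrant,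
and indices of `α` entries are positive. -/
def IsMixedTableau (T : MixedTableau) : Prop :=
  (mshape T).Finite ∧ (∀ c ∈ mshape T, 1 ≤ c.1 ∧ 1 ≤ c.2) ∧
    ∀ c k, T c = some (MEntry.al k) → 0 < k

/-- `T` is a filling of the skew shape `mu / lam`. -/
def HasSkewShape (T : MixedTableau) (lam mu : Set Cell) : Prop :=
  IsPartitionShape lam ∧ IsPartitionShape mu ∧ lam ⊆ mu ∧ mshape T = mu \ lam

/-- `γ`-column-strictness for the entries selected by `p`:
indices weakly decrease to the northeast, and no two selected entries in the
same column have equal indices. -/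
def ColumnStrictFor (p : MEntry → Prop) (T : MixedTableau) : Prop :=
  (∀ c c' e e', T c = some e → T c' = some e' → p e → p e' →
      c.1 ≤ c'.1 → c.2 ≤ c'.2 → MEntry.idx e' ≤ MEntry.idx e) ∧
  (∀ c c' e e', T c = some e → T c' = some e' → p e → p e' →
      c.2 = c'.2 → c ≠ c' → MEntry.idx e ≠ MEntry.idx e')

/-- `γ`-row-strictness for the entries selected by `p`. -/
def RowStrictFor (p : MEntry → Prop) (T : MixedTableau) : Prop :=
  (∀ c c' e e', T c = some e → T c' = some e' → p e → p e' →
      c.1 ≤ c'.1 → c.2 ≤ c'.2 → MEntry.idx e' ≤ MEntry.idx e) ∧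
  (∀ c c' e e', T c = some e → T c' = some e' → p e → p e' →
      c.1 = c'.1 → c ≠ c' → MEntry.idx e ≠ MEntry.idx e')

def AlphaColumnStrict (T : MixedTableau) : Prop := ColumnStrictFor MEntry.isAlpha T
def AlphaRowStrict (T : MixedTableau) : Prop := RowStrictFor MEntry.isAlpha T
def BetaColumnStrict (T : MixedTableau) : Prop := ColumnStrictFor MEntry.isBeta T
def BetaRowStrict (T : MixedTableau) : Prop := RowStrictFor MEntry.isBeta T

def alphaCells (T : MixedTableau) : Set Cell := {c | ∃ k, T c = some (MEntry.al k)}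
def betaCells (T : MixedTableau) : Set Cell := {c | ∃ k, T c = some (MEntry.be k)}

/-- `(α,β)`-sortedness relative to the skew shape `mu / lam`: the `α`-cells form
`nu / lam` and the `β`-cells form `mu / nu` for some partition `nu`. -/
def ABSortedShape (T : MixedTableau) (lam mu : Set Cell) : Prop :=
  ∃ nu : Set Cell, IsPartitionShape nu ∧ lam ⊆ nu ∧ nu ⊆ mu ∧
    alphaCells T = nu \ lam ∧ betaCells T = mu \ nu

/-- `(α,β)`-sorted. -/
def ABSorted (T : MixedTableau) : Prop :=
  ∃ lam mu : Set Cell, HasSkewShape T lam mu ∧ ABSortedShape T lam mu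

/-- `(β,α)`-sortedness relative to the skew shape `mu / lam`. -/
def BASortedShape (T : MixedTableau) (lam mu : Set Cell) : Prop :=
  ∃ nu : Set Cell, IsPartitionShape nu ∧ lam ⊆ nu ∧ nu ⊆ mu ∧
    betaCells T = nu \ lam ∧ alphaCells T = mu \ nu

/-- `(β,α)`-sorted. -/
def BASorted (T : MixedTableau) : Prop :=
  ∃ lam mu : Set Cell, HasSkewShape T lam mu ∧ BASortedShape T lam mu

/-- Interchange the contents of two cells. -/
def swapCells (T : MixedTableau) (c c' : Cell) : MixedTableau :=
  Function.update (Function.update T c (T c')) c' (T c)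

/-- A switch: interchange an `α_r` with a `β_s` directly to its right or
directly above it, provided both the source and the result are
`α`-column-strict and `β`-row-strict. -/
def Switch (T T' : MixedTableau) : Prop :=
  AlphaColumnStrict T ∧ BetaRowStrict T ∧
  ∃ c c' : Cell, (c' = rtCell c ∨ c' = upCell c) ∧
    (∃ r, T c = some (MEntry.al r)) ∧ (∃ s, T c' = some (MEntry.be s)) ∧
    T' = swapCells T c c' ∧ AlphaColumnStrict T' ∧ BetaRowStrict T'

/-- Fully switched: no switch is possible. -/
def FullySwitched (T : MixedTableau) : Prop := ¬ ∃ T', Switch T T'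

/-- The cell `c` contains a `β` entry. -/
def isBetaCell (T : MixedTableau) (c : Cell) : Prop := ∃ k, T c = some (MEntry.be k)

/-- One step of the switching process of the shuffle: the `α` entry at `c`
moves to the cell `c'` (above or to the right), following the tie-breaking
rule of the jeu de taquin shuffle. -/
def ShuffMoveTo (Q : MixedTableau) (c c' : Cell) (Q' : MixedTableau) : Prop :=
  (∃ i, Q c = some (MEntry.al i)) ∧ Q' = swapCells Q c c' ∧
  ((isBetaCell Q (rtCell c) ∧ ¬ isBetaCell Q (upCell c) ∧ c' = rtCell c) ∨
   (isBetaCell Q (upCell c) ∧ ¬ isBetaCell Q (rtCell c) ∧ c' = upCell c) ∨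
   (∃ k j, Q (upCell c) = some (MEntry.be k) ∧ Q (rtCell c) = some (MEntry.be j) ∧
      ((j < k ∧ c' = upCell c) ∨ (k ≤ j ∧ c' = rtCell c))))

/-- The `α` entry at `c` is settled: the cells above and to the right of it
contain `α` entries or are empty. -/
def ShuffSettled (Q : MixedTableau) (c : Cell) : Prop :=
  ¬ isBetaCell Q (upCell c) ∧ ¬ isBetaCell Q (rtCell c)

/-- The full switching process of a single chosen `α` entry, starting at cell `c`,
until it is settled. -/
inductive ShuffTrack : MixedTableau → Cell → MixedTableau → Prop
  | done : ∀ Q c, ShuffSettled Q c → ShuffTrack Q c Q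
  | step : ∀ Q c c' Q' R, ShuffMoveTo Q c c' Q' → ShuffTrack Q' c' R → ShuffTrack Q c R

/-- The cell `c` holds an `α` entry having a `β` entry directly above or
directly to its right. -/
def ShuffPending (Q : MixedTableau) (c : Cell) : Prop :=
  (∃ i, Q c = some (MEntry.al i)) ∧ (isBetaCell Q (upCell c) ∨ isBetaCell Q (rtCell c))

/-- Among the pending `α` entries, the rightmost one with the smallest index. -/
def ShuffChosen (Q : MixedTableau) (c : Cell) : Prop :=
  ShuffPending Q c ∧ ∃ i, Q c = some (MEntry.al i) ∧
    (∀ c' i', ShuffPending Q c' → Q c' = some (MEntry.al i') → i ≤ i') ∧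
    (∀ c', ShuffPending Q c' → Q c' = some (MEntry.al i) → c'.2 ≤ c.2)

/-- `ShuffRel Q R` means `R = shuff(Q)`, the jeu de taquin shuffle of `Q`. -/
inductive ShuffRel : MixedTableau → MixedTableau → Prop
  | done : ∀ Q, (∀ c, ¬ ShuffPending Q c) → ShuffRel Q Q
  | step : ∀ Q c Q' R, ShuffChosen Q c → ShuffTrack Q c Q' → ShuffRel Q' R → ShuffRel Q R

/-- The entry `α_r` at `c` is out of order via its right neighbour. -/
def OutOfOrderH (T : MixedTableau) (c : Cell) : Prop :=
  ∃ r s : ℤ, T c = some (MEntry.al r) ∧ T (rtCell c) = some (MEntry.be s) ∧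
    r < s + ((c.2 : ℤ) + 1) - (c.1 : ℤ)

/-- The entry `α_r` at `c` is out of order via its upper neighbour. -/
def OutOfOrderV (T : MixedTableau) (c : Cell) : Prop :=
  ∃ r t : ℤ, T c = some (MEntry.al r) ∧ T (upCell c) = some (MEntry.be t) ∧
    r ≤ t + (c.2 : ℤ) - ((c.1 : ℤ) + 1)

def OutOfOrder (T : MixedTableau) (c : Cell) : Prop := OutOfOrderH T c ∨ OutOfOrderV T c

/-- The GG-jdt slide at the cell `c`. -/
def GGSlide (T : MixedTableau) (c : Cell) (T' : MixedTableau) : Prop :=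
  (OutOfOrderH T c ∧ ¬ OutOfOrderV T c ∧ T' = swapCells T c (rtCell c)) ∨
  (OutOfOrderV T c ∧ ¬ OutOfOrderH T c ∧ T' = swapCells T c (upCell c)) ∨
  (OutOfOrderH T c ∧ OutOfOrderV T c ∧
    ∃ s t : ℤ, T (rtCell c) = some (MEntry.be s) ∧ T (upCell c) = some (MEntry.be t) ∧
      ((t ≤ s ∧ T' = swapCells T c (rtCell c)) ∨ (s < t ∧ T' = swapCells T c (upCell c))))

/-- The cell chosen by the GG-jdt map: the rightmost cell containing an
out-of-order `α_r` with `r` smallest. -/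
def GGChosen (T : MixedTableau) (c : Cell) : Prop :=
  ∃ r : ℤ, T c = some (MEntry.al r) ∧ OutOfOrder T c ∧
    (∀ c' r', T c' = some (MEntry.al r') → OutOfOrder T c' → r ≤ r') ∧
    (∀ c', T c' = some (MEntry.al r) → OutOfOrder T c' → c'.2 ≤ c.2)

/-- One iteration of the GG-jdt map. -/
def GGStep (T T' : MixedTableau) : Prop := ∃ c, GGChosen T c ∧ GGSlide T c T'

/-- `GGRel T R` means `R = jdt_GG(T)`. -/
def GGRel (T R : MixedTableau) : Prop :=
  Relation.ReflTransGen GGStep T R ∧ ∀ c, ¬ OutOfOrder R c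

/-- `c_β^+`: replace each `β_r` in a cell of content `c = j - i` by `β_{r+c}`. -/
def cBetaPlus (T : MixedTableau) : MixedTableau := fun c =>
  match T c with
  | some (MEntry.be r) => some (MEntry.be (r + ((c.2 : ℤ) - (c.1 : ℤ))))
  | o => o

/-- Totally column-strict: indices strictly decrease up columns and weakly
decrease along rows. -/
def TotallyColumnStrict (T : MixedTableau) : Prop :=
  (∀ c e e', T c = some e → T (upCell c) = some e' → MEntry.idx e' < MEntry.idx e) ∧
  (∀ c e e', T c = some e → T (rtCell c) = some e' → MEntry.idx e' ≤ MEntry.idx e)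

/-- Flagged-mixed tableau: `α_k` in column `j` forces `0 < k < j`, and
`β_k` in row `i` forces `0 < k < i`. -/
def IsFMT (T : MixedTableau) : Prop :=
  (∀ c k, T c = some (MEntry.al k) → 0 < k ∧ k < (c.2 : ℤ)) ∧
  (∀ c k, T c = some (MEntry.be k) → 0 < k ∧ k < (c.1 : ℤ))

/-- Exquisite tableau of shape `mu / lam`. -/
def IsEXQ (lam mu : Set Cell) (E : MixedTableau) : Prop :=
  IsMixedTableau E ∧ HasSkewShape E lam mu ∧ IsFMT E ∧
    TotallyColumnStrict (cBetaPlus E)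

/-- Biflagged tableau of shape `mu / lam`. -/
def IsBFT (lam mu : Set Cell) (Q : MixedTableau) : Prop :=
  IsMixedTableau Q ∧ HasSkewShape Q lam mu ∧
  AlphaColumnStrict Q ∧ BetaRowStrict Q ∧ ABSortedShape Q lam mu ∧
  IsFMT Q ∧ (∃ R, ShuffRel Q R) ∧ (∀ R, ShuffRel Q R → IsFMT R)

/-- Number of occurrences of the entry `e` in the mixed tableau `Q`:
the exponent of the corresponding variable in `wt(Q)`. -/
noncomputable def mcount (Q : MixedTableau) (e : MEntry) : ℕ :=
  Set.ncard {c | Q c = some e}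

/-! ### Hook-valued tableaux -/

/-- A hook: a hook entry, a list of leg entries and a list of arm entries. -/
structure Hook : Type where
  hk : ℕ
  legs : List ℕ
  arms : List ℕ
  deriving DecidableEq

/-- Valid hook: positive entries, `hk < L₁ < ⋯ < L_ℓ` and `hk ≤ A₁ ≤ ⋯ ≤ A_k`. -/
def Hook.Valid (H : Hook) : Prop :=
  1 ≤ H.hk ∧ H.legs.Chain' (· < ·) ∧ (∀ x ∈ H.legs, H.hk < x) ∧
  H.arms.Chain' (· ≤ ·) ∧ ∀ x ∈ H.arms, H.hk ≤ x

/-- The multiset of all entries of a hook. -/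
def Hook.entries (H : Hook) : Multiset ℕ :=
  H.hk ::ₘ ((H.legs : Multiset ℕ) + (H.arms : Multiset ℕ))

/-- A hook-valued filling. -/
abbrev HVTab : Type := Cell → Option Hook

def hshape (T : HVTab) : Set Cell := {c | T c ≠ none}

noncomputable def hsize (T : HVTab) : ℕ := (hshape T).ncard

def hentriesAt (T : HVTab) (c : Cell) : Multiset ℕ :=
  match T c with
  | some H => H.entries
  | none => 0

def armsAt (T : HVTab) (c : Cell) : List ℕ :=
  match T c with
  | some H => H.arms
  | none => []

def legsAt (T : HVTab) (c : Cell) : List ℕ :=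
  match T c with
  | some H => H.legs
  | none => []

/-- Hook-valued tableau: partition shape, valid hooks, rows weakly increasing
(entrywise) and columns strictly increasing (entrywise). -/
def IsHVT (T : HVTab) : Prop :=
  IsPartitionShape (hshape T) ∧
  (∀ c H, T c = some H → H.Valid) ∧
  (∀ c, ∀ x ∈ hentriesAt T c, ∀ y ∈ hentriesAt T (rtCell c), x ≤ y) ∧
  (∀ c, ∀ x ∈ hentriesAt T c, ∀ y ∈ hentriesAt T (upCell c), x < y)

def NoArms (T : HVTab) : Prop := ∀ c, armsAt T c = []
def NoLegs (T : HVTab) : Prop := ∀ c, legsAt T c = []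

/-- Insert into a sorted list. -/
def insSorted (x : ℕ) : List ℕ → List ℕ
  | [] => [x]
  | y :: ys => if x ≤ y then x :: y :: ys else y :: insSorted x ys

def insSortedAll (xs : List ℕ) (l : List ℕ) : List ℕ :=
  xs.foldl (fun acc x => insSorted x acc) l

/-- In arm-uncrowding, the receiving cell's hook: replace its entry `k`
(the smallest entry `≥ a`) by `a` and insert `k` as an arm entry. -/
def Hook.receiveArm (H : Hook) (a k : ℕ) : Hook :=
  if H.hk = k then ⟨a, H.legs, insSorted k H.arms⟩
  else if k ∈ H.legs then ⟨H.hk, insSorted a (H.legs.erase k), insSorted k H.arms⟩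
  else ⟨H.hk, H.legs, insSorted a H.arms⟩

/-- In leg-uncrowding, the receiving cell's hook: replace its entry `k`
(the smallest entry `> l`) by `l` and insert `k` as a leg entry. -/
def Hook.receiveLeg (H : Hook) (l k : ℕ) : Hook :=
  if H.hk = k then ⟨l, insSorted k H.legs, H.arms⟩
  else if k ∈ H.legs then ⟨H.hk, insSorted l H.legs, H.arms⟩
  else ⟨H.hk, insSorted k H.legs, insSorted l (H.arms.erase k)⟩

/-- Add the arm entries `xs` to the cell `c` of `T`. -/
def addArmsAt (T : HVTab) (c : Cell) (xs : List ℕ) : HVTab :=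
  if xs = [] then T
  else
    match T c with
    | some H => Function.update T c (some ⟨H.hk, H.legs, insSortedAll xs H.arms⟩)
    | none => Function.update T c (some ⟨xs.headI, [], xs.tail⟩)

/-- The arm entry selected by arm-uncrowding: `a` is the largest arm entry in
the rightmost column `c` containing an arm entry, located in cell `(r, c)`. -/
def SelectedArm (T : HVTab) (r c a : ℕ) : Prop :=
  a ∈ armsAt T (r, c) ∧
  (∀ r' x, x ∈ armsAt T (r', c) → x ≤ a) ∧
  (∀ r' c', c < c' → armsAt T (r', c') = [])

/-- The leg entry selected by leg-uncrowding: `l` is the largest leg entry in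
the topmost row `r` containing a leg entry, located in cell `(r, c)`. -/
def SelectedLeg (T : HVTab) (r c l : ℕ) : Prop :=
  l ∈ legsAt T (r, c) ∧
  (∀ c' x, x ∈ legsAt T (r, c') → x ≤ l) ∧
  (∀ r' c', r < r' → legsAt T (r', c') = [])

/-- `k` is the smallest entry `≥ a` in column `col`, located in row `rr`. -/
def SmallestGE (T : HVTab) (col a k rr : ℕ) : Prop :=
  k ∈ hentriesAt T (rr, col) ∧ a ≤ k ∧
  ∀ r' y, y ∈ hentriesAt T (r', col) → a ≤ y → k ≤ y

/-- `k` is the smallest entry `> l` in row `row`, located in column `cc`. -/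
def SmallestGT (T : HVTab) (row l k cc : ℕ) : Prop :=
  k ∈ hentriesAt T (row, cc) ∧ l < k ∧
  ∀ c' y, y ∈ hentriesAt T (row, c') → l < y → k ≤ y

/-- The arm-uncrowding bumping `A_b`. -/
def ArmBumpRel (T T' : HVTab) : Prop :=
  (NoArms T ∧ T' = T) ∨
  (∃ r c a H, T (r, c) = some H ∧ SelectedArm T r c a ∧
    ((∃ k rr HT, SmallestGE T (c + 1) a k rr ∧ T (rr, c + 1) = some HT ∧
        ((rr ≠ r ∧
            T' = Function.update (Function.update T (r, c)
                (some ⟨H.hk, H.legs, H.arms.erase a⟩)) (rr, c + 1)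
                (some (Hook.receiveArm HT a k))) ∨
         (rr = r ∧
            T' = Function.update (Function.update T (r, c)
                (some ⟨H.hk, H.legs.filter (fun x => decide (x ≤ a)), H.arms.erase a⟩))
                (r, c + 1)
                (some ⟨(Hook.receiveArm HT a k).hk,
                       insSortedAll (H.legs.filter (fun x => decide (a < x)))
                         (Hook.receiveArm HT a k).legs,
                       (Hook.receiveArm HT a k).arms⟩)))) ∨
     ((∀ r' y, y ∈ hentriesAt T (r', c + 1) → y < a) ∧
        ∃ t, 1 ≤ t ∧ (∀ r', (r', c + 1) ∈ hshape T ↔ 1 ≤ r' ∧ r' < t) ∧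
        ((t ≠ r ∧
            T' = Function.update (Function.update T (r, c)
                (some ⟨H.hk, H.legs, H.arms.erase a⟩)) (t, c + 1)
                (some ⟨a, [], []⟩)) ∨
         (t = r ∧
            T' = Function.update (Function.update T (r, c)
                (some ⟨H.hk, H.legs.filter (fun x => decide (x ≤ a)), H.arms.erase a⟩))
                (r, c + 1)
                (some ⟨a, H.legs.filter (fun x => decide (a < x)), []⟩))))))

/-- The leg-uncrowding bumping `L_b`. -/
def LegBumpRel (T T' : HVTab) : Prop :=
  (NoLegs T ∧ T' = T) ∨
  (∃ r c l H, T (r, c) = some H ∧ SelectedLeg T r c l ∧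
    ((∃ k cc HT, SmallestGT T (r + 1) l k cc ∧ T (r + 1, cc) = some HT ∧
        ((cc ≠ c ∧
            T' = Function.update (Function.update T (r, c)
                (some ⟨H.hk, H.legs.erase l, H.arms⟩)) (r + 1, cc)
                (some (Hook.receiveLeg HT l k))) ∨
         (cc = c ∧
            T' = addArmsAt
              (Function.update (Function.update T (r, c)
                  (some ⟨H.hk, H.legs.erase l, H.arms.filter (fun x => decide (l < x))⟩))
                  (r + 1, c) (some (Hook.receiveLeg HT l k)))
              (r, c + 1) (H.arms.filter (fun x => decide (x ≤ l)))))) ∨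
     ((∀ c' y, y ∈ hentriesAt T (r + 1, c') → y ≤ l) ∧
        ∃ t, 1 ≤ t ∧ (∀ c', (r + 1, c') ∈ hshape T ↔ 1 ≤ c' ∧ c' < t) ∧
        ((t ≠ c ∧
            T' = Function.update (Function.update T (r, c)
                (some ⟨H.hk, H.legs.erase l, H.arms⟩)) (r + 1, t)
                (some ⟨l, [], []⟩)) ∨
         (t = c ∧
            T' = Function.update (Function.update T (r, c)
                (some ⟨H.hk, H.legs.erase l, H.arms.filter (fun x => decide (l < x))⟩))
                (r + 1, c)
                (some ⟨l, [], H.arms.filter (fun x => decide (x ≤ l))⟩))))))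

/-- `n`-fold composition of a relation. -/
def RelPow {α : Type*} (R : α → α → Prop) : ℕ → α → α → Prop
  | 0, a, b => a = b
  | n + 1, a, b => ∃ x, R a x ∧ RelPow R n x b

/-- The single-arm-uncrowding map `𝒜`. -/
def ArmRel (T T' : HVTab) : Prop :=
  (NoArms T ∧ T' = T) ∨
  (¬ NoArms T ∧ ∃ m : ℕ, RelPow ArmBumpRel m T T' ∧ hsize T' = hsize T + 1 ∧
    ∀ m' U, m' < m → RelPow ArmBumpRel m' T U → hsize U = hsize T)

/-- The single-leg-uncrowding map `ℒ`. -/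
def LegRel (T T' : HVTab) : Prop :=
  (NoLegs T ∧ T' = T) ∨
  (¬ NoLegs T ∧ ∃ m : ℕ, RelPow LegBumpRel m T T' ∧ hsize T' = hsize T + 1 ∧
    ∀ m' U, m' < m → RelPow LegBumpRel m' T U → hsize U = hsize T)

/-- The two kinds of uncrowding operators. -/
inductive Bump : Type
  | A
  | L
  deriving DecidableEq

def BumpRel : Bump → HVTab → HVTab → Prop
  | .A => ArmBumpRel
  | .L => LegBumpRel

/-- `T` has type `f_k^{(ε_k)} ⋯ f_1^{(ε_1)}`; the word is given as the list
`[(f_1, ε_1), …, (f_k, ε_k)]` in order of application. -/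
def HasType : HVTab → List (Bump × ℕ) → Prop
  | _, [] => True
  | T, (f, e) :: w => ∃ T', BumpRel f T T' ∧ hsize T' = hsize T + e ∧ HasType T' w

def StepRel : Bump → HVTab → HVTab → Prop
  | .A => ArmRel
  | .L => LegRel

def SelectedArmCol (T : HVTab) (c : ℕ) : Prop := ∃ r a, SelectedArm T r c a
def SelectedLegRow (T : HVTab) (r : ℕ) : Prop := ∃ c l, SelectedLeg T r c l

/-- The recorded entry of one uncrowding step applied to `T`. -/
def StepEntry : Bump → HVTab → MEntry → Prop
  | .A, T, e => ∃ c : ℕ, SelectedArmCol T c ∧ e = MEntry.al (c : ℤ)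
  | .L, T, e => ∃ r : ℕ, SelectedLegRow T r ∧ e = MEntry.be (r : ℤ)

/-- `UncrowdRec w T P Q` means `𝒰_w(T) = (P, Q)`, where `w` is the word listed
in order of application. -/
def UncrowdRec : List Bump → HVTab → HVTab → MixedTableau → Prop
  | [], T, P, Q => P = T ∧ ∀ c, Q c = none
  | f :: w, T, P, Q => ∃ T' Q', StepRel f T T' ∧ UncrowdRec w T' P Q' ∧
      (∀ cell, cell ∈ hshape T' → cell ∉ hshape T →
        ∃ e, StepEntry f T e ∧ Q cell = some e) ∧
      (∀ cell, ¬ (cell ∈ hshape T' ∧ cell ∉ hshape T) → Q cell = Q' cell)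

/-- `𝒰_{ℒ^∞𝒜^∞}(T) = (P, Q)`. -/
def UncrowdLAinf (T P : HVTab) (Q : MixedTableau) : Prop :=
  ∃ M N : ℕ, UncrowdRec (List.replicate M Bump.A ++ List.replicate N Bump.L) T P Q ∧
    NoArms P ∧ NoLegs P

/-- `𝒰_{𝒜^∞ℒ^∞}(T) = (P, Q)`. -/
def UncrowdALinf (T P : HVTab) (Q : MixedTableau) : Prop :=
  ∃ M N : ℕ, UncrowdRec (List.replicate N Bump.L ++ List.replicate M Bump.A) T P Q ∧
    NoArms P ∧ NoLegs P

/-- A semistandard Young tableau, seen as a hook-valued tableau all of whose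
hooks have no arm and no leg entries. -/
def IsSSYT (P : HVTab) : Prop := IsHVT P ∧ NoArms P ∧ NoLegs P

/-- Number of arm entries in column `j` of `T`: the exponent of `α_j` in `wt(T)`. -/
noncomputable def armCountCol (T : HVTab) (j : ℕ) : ℕ := ∑ᶠ i : ℕ, (armsAt T (i, j)).length

/-- Number of leg entries in row `i` of `T`: the exponent of `β_i` in `wt(T)`. -/
noncomputable def legCountRow (T : HVTab) (i : ℕ) : ℕ := ∑ᶠ j : ℕ, (legsAt T (i, j)).length

/-- Number of entries of `T` equal to `v`: the exponent of `x_v` in `wt(T)`. -/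
noncomputable def entryCount (T : HVTab) (v : ℕ) : ℕ := ∑ᶠ c : Cell, (hentriesAt T c).count v

noncomputable def armCountColZ (T : HVTab) (k : ℤ) : ℕ :=
  if 0 ≤ k then armCountCol T k.toNat else 0

noncomputable def legCountRowZ (T : HVTab) (k : ℤ) : ℕ :=
  if 0 ≤ k then legCountRow T k.toNat else 0

/-- `wt(T) = wt(P) · wt(Q)` for a hook-valued tableau `T`, a semistandard
Young tableau `P` (as a hook-valued tableau) and a mixed tableau `Q`. -/
def WtEq (T P : HVTab) (Q : MixedTableau) : Prop :=
  (∀ j : ℕ, armCountCol T j = mcount Q (MEntry.al (j : ℤ))) ∧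
  (∀ i : ℕ, legCountRow T i = mcount Q (MEntry.be (i : ℤ))) ∧
  (∀ k : ℤ, k ≤ 0 → mcount Q (MEntry.al k) = 0 ∧ mcount Q (MEntry.be k) = 0) ∧
  (∀ v : ℕ, entryCount T v = entryCount P v)

theorem swapCells_apply (T : MixedTableau) (c c' d : Cell) :
    swapCells T c c' d = T (Equiv.swap c c' d) := by
  unfold swapCells
  rcases eq_or_ne d c' with rfl | h'
  · simp
  · rcases eq_or_ne d c with rfl | h
    · simp [h']
    · simp [h, h', Equiv.swap_apply_of_ne_of_ne]

theorem swapCells_left (T : MixedTableau) (c c' : Cell) : swapCells T c c' c = T c' := by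
  simp [swapCells_apply]

theorem swapCells_right (T : MixedTableau) (c c' : Cell) : swapCells T c c' c' = T c := by
  simp [swapCells_apply]

theorem swapCells_of_ne (T : MixedTableau) {c c' d : Cell} (h : d ≠ c) (h' : d ≠ c') :
    swapCells T c c' d = T d := by
  rw [swapCells_apply, Equiv.swap_apply_of_ne_of_ne h h']

theorem le_of_adjacent {c c' : Cell} (h : c' = rtCell c ∨ c' = upCell c) : c ≤ c' := by
  rcases h with rfl | rfl <;> simp [rtCell, upCell, Prod.le_def]

/-- `α`-column-strictness, unfolded on indices. -/
theorem alphaColumnStrict_iff {T : MixedTableau} : AlphaColumnStrict T ↔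
    (∀ c c' r r', c ≤ c' → T c = some (.al r) → T c' = some (.al r') → r' ≤ r) ∧
    (∀ c c' r, c.2 = c'.2 → T c = some (.al r) → T c' = some (.al r) → c = c') := by
  constructor
  · rintro ⟨h, h'⟩
    refine ⟨fun c c' r r' hc e e' => h c c' _ _ e e' trivial trivial hc.1 hc.2,
      fun c c' r hc e e' => ?_⟩
    by_contra hn
    exact h' c c' _ _ e e' trivial trivial hc hn rfl
  · rintro ⟨h, h'⟩
    refine ⟨?_, ?_⟩
    · rintro c c' (r | r) (r' | r') e e' p p' h1 h2
      · exact h c c' r r' ⟨h1, h2⟩ e e'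
      all_goals first | exact False.elim p' | exact False.elim p
    · rintro c c' (r | r) (r' | r') e e' p p' h1 h2 h3
      · obtain rfl : r = r' := h3
        exact h2 (h' c c' r h1 e e')
      all_goals first | exact False.elim p' | exact False.elim p

/-- `β`-row-strictness, unfolded on indices. -/
theorem betaRowStrict_iff {T : MixedTableau} : BetaRowStrict T ↔
    (∀ c c' s s', c ≤ c' → T c = some (.be s) → T c' = some (.be s') → s' ≤ s) ∧
    (∀ c c' s, c.1 = c'.1 → T c = some (.be s) → T c' = some (.be s) → c = c') := by
  constructor
  · rintro ⟨h, h'⟩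
    refine ⟨fun c c' r r' hc e e' => h c c' _ _ e e' trivial trivial hc.1 hc.2,
      fun c c' r hc e e' => ?_⟩
    by_contra hn
    exact h' c c' _ _ e e' trivial trivial hc hn rfl
  · rintro ⟨h, h'⟩
    refine ⟨?_, ?_⟩
    · rintro c c' (r | r) (r' | r') e e' p p' h1 h2
      pick_goal 4
      · exact h c c' r r' ⟨h1, h2⟩ e e'
      all_goals first | exact False.elim p' | exact False.elim p
    · rintro c c' (r | r) (r' | r') e e' p p' h1 h2 h3
      pick_goal 4
      · obtain rfl : r = r' := h3
        exact h2 (h' c c' r h1 e e')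
      all_goals first | exact False.elim p' | exact False.elim p

/-! ### Confluence of switching -/

section Commute

variable {T : MixedTableau} {c' d' c d : Cell} {r' s' r s : ℤ}

/-- Two switches of the same `α` are never both possible. -/
theorem switch_target_unique
    (h : c' = rtCell c ∨ c' = upCell c) (h' : d' = rtCell c ∨ d' = upCell c)
    (hc' : T c' = some (.be s)) (hd' : T d' = some (.be s'))
    (hA : BetaRowStrict (swapCells T c c')) (hB : BetaRowStrict (swapCells T c d')) :
    c' = d' := by
  wlog hw : c' = rtCell c ∧ d' = upCell c generalizing c' d' s s'
  · rcases h with rfl | rfl <;> rcases h' with rfl | rfl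
    · rfl
    · exact absurd ⟨rfl, rfl⟩ hw
    · exact (this (.inl rfl) (.inr rfl) hd' hc' hB hA ⟨rfl, rfl⟩).symm
    · rfl
  obtain ⟨rfl, rfl⟩ := hw
  exfalso
  rw [betaRowStrict_iff] at hA hB
  have n1 : upCell c ≠ c := by simp [upCell, Prod.ext_iff]
  have n2 : upCell c ≠ rtCell c := by simp [upCell, rtCell, Prod.ext_iff]
  have n3 : rtCell c ≠ c := by simp [rtCell, Prod.ext_iff]
  have a1 : swapCells T c (rtCell c) c = some (.be s) := by rw [swapCells_left, hc']
  have a2 : swapCells T c (rtCell c) (upCell c) = some (.be s') := by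
    rw [swapCells_of_ne _ n1 n2, hd']
  have b1 : swapCells T c (upCell c) c = some (.be s') := by rw [swapCells_left, hd']
  have b2 : swapCells T c (upCell c) (rtCell c) = some (.be s) := by
    rw [swapCells_of_ne _ n3 n2.symm, hc']
  have h1 := hA.1 _ _ _ _ (le_of_adjacent (.inr rfl)) a1 a2
  have h2 := hB.1 _ _ _ _ (le_of_adjacent (.inl rfl)) b1 b2
  obtain rfl : s = s' := le_antisymm h2 h1
  exact n3 (hB.2 c (rtCell c) _ rfl b1 b2).symm

/-- Two switches of the same `β` are never both possible. -/
theorem switch_source_unique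
    (h : c' = rtCell c ∨ c' = upCell c) (h' : c' = rtCell d ∨ c' = upCell d)
    (hc : T c = some (.al r)) (hd : T d = some (.al r'))
    (hA : AlphaColumnStrict (swapCells T c c')) (hB : AlphaColumnStrict (swapCells T d c')) :
    c = d := by
  wlog hw : c' = rtCell c ∧ c' = upCell d generalizing c d r r'
  · rcases h with h | h <;> rcases h' with h' | h'
    · simp only [h, rtCell, Prod.ext_iff] at h' ⊢; omega
    · exact absurd ⟨h, h'⟩ hw
    · exact (this (.inl h') (.inr h) hd hc hB hA ⟨h', h⟩).symm
    · simp only [h, upCell, Prod.ext_iff] at h' ⊢; omega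
  obtain ⟨e1, e2⟩ := hw
  exfalso
  rw [alphaColumnStrict_iff] at hA hB
  have n1 : d ≠ c := by
    rintro rfl; rw [e1] at e2; simp [upCell, rtCell, Prod.ext_iff] at e2
  have n2 : d ≠ c' := by rw [e2]; simp [upCell, Prod.ext_iff]
  have n3 : c ≠ c' := by rw [e1]; simp [rtCell, Prod.ext_iff]
  have a1 : swapCells T c c' c' = some (.al r) := by rw [swapCells_right, hc]
  have a2 : swapCells T c c' d = some (.al r') := by rw [swapCells_of_ne _ n1 n2, hd]
  have b1 : swapCells T d c' c' = some (.al r') := by rw [swapCells_right, hd]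
  have b2 : swapCells T d c' c = some (.al r) := by rw [swapCells_of_ne _ n1.symm n3, hc]
  have h1 := hA.1 _ _ _ _ (le_of_adjacent h') a2 a1
  have h2 := hB.1 _ _ _ _ (le_of_adjacent h) b2 b1
  obtain rfl : r = r' := le_antisymm h1 h2
  exact n2 (hA.2 _ _ _ (by rw [e2]; rfl) a2 a1)

theorem swapCells_comm (h1 : c ≠ d) (h2 : c ≠ d') (h3 : c' ≠ d) (h4 : c' ≠ d') :
    swapCells (swapCells T c c') d d' = swapCells (swapCells T d d') c c' := by
  funext x
  simp only [swapCells_apply]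
  congr 1
  simp only [Equiv.swap_apply_def]
  split_ifs <;> simp_all

theorem alphaColumnStrict_swap_swap (h1 : c ≠ d) (h2 : c ≠ d') (h3 : c' ≠ d) (h4 : c' ≠ d')
    (hc : T c = some (.al r)) (hc' : T c' = some (.be s))
    (hd : T d = some (.al r')) (hd' : T d' = some (.be s'))
    (h : c' = rtCell c ∨ c' = upCell c) (h' : d' = rtCell d ∨ d' = upCell d)
    (hT : AlphaColumnStrict T) (hA : AlphaColumnStrict (swapCells T c c'))
    (hB : AlphaColumnStrict (swapCells T d d')) :
    AlphaColumnStrict (swapCells (swapCells T c c') d d') := by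
  have hcomm := swapCells_comm (T := T) h1 h2 h3 h4
  rw [alphaColumnStrict_iff] at *
  have eA : ∀ x, x ≠ d → x ≠ d' →
      swapCells (swapCells T c c') d d' x = swapCells T c c' x :=
    fun x => swapCells_of_ne _
  have eB : ∀ x, x ≠ c → x ≠ c' →
      swapCells (swapCells T c c') d d' x = swapCells T d d' x :=
    fun x => by rw [hcomm]; exact swapCells_of_ne _
  have nc : ∀ x k, swapCells (swapCells T c c') d d' x = some (.al k) → x ≠ c := by
    rintro x k e rfl
    rw [eA _ h1 h2, swapCells_left, hc'] at e; simp at e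
  have nd : ∀ x k, swapCells (swapCells T c c') d d' x = some (.al k) → x ≠ d := by
    rintro x k e rfl
    rw [eB _ h1.symm h3.symm, swapCells_left, hd'] at e; simp at e
  have vc : swapCells (swapCells T c c') d d' c' = some (.al r) := by
    rw [eA _ h3 h4, swapCells_right, hc]
  have vd : swapCells (swapCells T c c') d d' d' = some (.al r') := by
    rw [eB _ h2.symm h4.symm, swapCells_right, hd]
  have A1 : swapCells T c c' c' = some (.al r) := by rw [swapCells_right, hc]
  have A2 : swapCells T c c' d = some (.al r') := by
    rw [swapCells_of_ne _ h1.symm h3.symm, hd]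
  have B1 : swapCells T d d' d' = some (.al r') := by rw [swapCells_right, hd]
  have B2 : swapCells T d d' c = some (.al r) := by rw [swapCells_of_ne _ h1 h2, hc]
  have key : r = r' → c'.2 ≠ d'.2 := by
    rintro rfl hcol
    rcases h with e | e
    · rcases h' with e' | e'
      · refine h1 (hT.2 _ _ _ ?_ hc hd)
        simpa [e, e', rtCell] using hcol
      · refine h3 (hA.2 _ _ _ ?_ A1 A2)
        simpa [e', upCell] using hcol
    · refine h2 (hB.2 _ _ _ ?_ B2 B1)
      simpa [e, upCell] using hcol
  constructor
  · intro x y k k' hxy ex ey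
    by_cases hd1 : x ≠ d' ∧ y ≠ d'
    · rw [eA _ (nd _ _ ex) hd1.1] at ex
      rw [eA _ (nd _ _ ey) hd1.2] at ey
      exact hA.1 _ _ _ _ hxy ex ey
    by_cases hc1 : x ≠ c' ∧ y ≠ c'
    · rw [eB _ (nc _ _ ex) hc1.1] at ex
      rw [eB _ (nc _ _ ey) hc1.2] at ey
      exact hB.1 _ _ _ _ hxy ex ey
    obtain ⟨rfl, rfl⟩ | ⟨rfl, rfl⟩ : (x = c' ∧ y = d') ∨ (x = d' ∧ y = c') := by
      grind
    · rw [vc] at ex; rw [vd] at ey; cases ex; cases ey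
      exact hB.1 _ _ _ _ ((le_of_adjacent h).trans hxy) B2 B1
    · rw [vd] at ex; rw [vc] at ey; cases ex; cases ey
      exact hA.1 _ _ _ _ ((le_of_adjacent h').trans hxy) A2 A1
  · intro x y k hxy ex ey
    by_cases hd1 : x ≠ d' ∧ y ≠ d'
    · rw [eA _ (nd _ _ ex) hd1.1] at ex
      rw [eA _ (nd _ _ ey) hd1.2] at ey
      exact hA.2 _ _ _ hxy ex ey
    by_cases hc1 : x ≠ c' ∧ y ≠ c'
    · rw [eB _ (nc _ _ ex) hc1.1] at ex
      rw [eB _ (nc _ _ ey) hc1.2] at ey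
      exact hB.2 _ _ _ hxy ex ey
    obtain ⟨rfl, rfl⟩ | ⟨rfl, rfl⟩ : (x = c' ∧ y = d') ∨ (x = d' ∧ y = c') := by
      grind
    · rw [vc] at ex; rw [vd] at ey; cases ex; cases ey
      exact absurd hxy (key rfl)
    · rw [vd] at ex; rw [vc] at ey; cases ex; cases ey
      exact absurd hxy.symm (key rfl)

theorem betaRowStrict_swap_swap (h1 : c ≠ d) (h2 : c ≠ d') (h3 : c' ≠ d) (h4 : c' ≠ d')
    (hc : T c = some (.al r)) (hc' : T c' = some (.be s))
    (hd : T d = some (.al r')) (hd' : T d' = some (.be s'))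
    (h : c' = rtCell c ∨ c' = upCell c) (h' : d' = rtCell d ∨ d' = upCell d)
    (hT : BetaRowStrict T) (hA : BetaRowStrict (swapCells T c c'))
    (hB : BetaRowStrict (swapCells T d d')) :
    BetaRowStrict (swapCells (swapCells T c c') d d') := by
  have hcomm := swapCells_comm (T := T) h1 h2 h3 h4
  rw [betaRowStrict_iff] at *
  have eA : ∀ x, x ≠ d → x ≠ d' →
      swapCells (swapCells T c c') d d' x = swapCells T c c' x :=
    fun x => swapCells_of_ne _
  have eB : ∀ x, x ≠ c → x ≠ c' →
      swapCells (swapCells T c c') d d' x = swapCells T d d' x :=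
    fun x => by rw [hcomm]; exact swapCells_of_ne _
  have nc : ∀ x k, swapCells (swapCells T c c') d d' x = some (.be k) → x ≠ c' := by
    rintro x k e rfl
    rw [eA _ h3 h4, swapCells_right, hc] at e; simp at e
  have nd : ∀ x k, swapCells (swapCells T c c') d d' x = some (.be k) → x ≠ d' := by
    rintro x k e rfl
    rw [eB _ h2.symm h4.symm, swapCells_right, hd] at e; simp at e
  have vc : swapCells (swapCells T c c') d d' c = some (.be s) := by
    rw [eA _ h1 h2, swapCells_left, hc']
  have vd : swapCells (swapCells T c c') d d' d = some (.be s') := by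
    rw [eB _ h1.symm h3.symm, swapCells_left, hd']
  have A1 : swapCells T c c' c = some (.be s) := by rw [swapCells_left, hc']
  have A2 : swapCells T c c' d' = some (.be s') := by
    rw [swapCells_of_ne _ h2.symm h4.symm, hd']
  have B1 : swapCells T d d' d = some (.be s') := by rw [swapCells_left, hd']
  have B2 : swapCells T d d' c' = some (.be s) := by rw [swapCells_of_ne _ h3 h4, hc']
  have key : s = s' → c.1 ≠ d.1 := by
    rintro rfl hrow
    rcases h with e | e
    · refine h3 (hB.2 _ _ _ ?_ B2 B1)
      simpa [e, rtCell] using hrow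
    · rcases h' with e' | e'
      · refine h2 (hA.2 _ _ _ ?_ A1 A2)
        simpa [e', rtCell] using hrow
      · refine h4 (hT.2 _ _ _ ?_ hc' hd')
        simpa [e, e', upCell] using hrow
  constructor
  · intro x y k k' hxy ex ey
    by_cases hd1 : x ≠ d ∧ y ≠ d
    · rw [eA _ hd1.1 (nd _ _ ex)] at ex
      rw [eA _ hd1.2 (nd _ _ ey)] at ey
      exact hA.1 _ _ _ _ hxy ex ey
    by_cases hc1 : x ≠ c ∧ y ≠ c
    · rw [eB _ hc1.1 (nc _ _ ex)] at ex
      rw [eB _ hc1.2 (nc _ _ ey)] at ey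
      exact hB.1 _ _ _ _ hxy ex ey
    obtain ⟨rfl, rfl⟩ | ⟨rfl, rfl⟩ : (x = c ∧ y = d) ∨ (x = d ∧ y = c) := by
      grind
    · rw [vc] at ex; rw [vd] at ey; cases ex; cases ey
      exact hA.1 _ _ _ _ (hxy.trans (le_of_adjacent h')) A1 A2
    · rw [vd] at ex; rw [vc] at ey; cases ex; cases ey
      exact hB.1 _ _ _ _ (hxy.trans (le_of_adjacent h)) B1 B2
  · intro x y k hxy ex ey
    by_cases hd1 : x ≠ d ∧ y ≠ d
    · rw [eA _ hd1.1 (nd _ _ ex)] at ex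
      rw [eA _ hd1.2 (nd _ _ ey)] at ey
      exact hA.2 _ _ _ hxy ex ey
    by_cases hc1 : x ≠ c ∧ y ≠ c
    · rw [eB _ hc1.1 (nc _ _ ex)] at ex
      rw [eB _ hc1.2 (nc _ _ ey)] at ey
      exact hB.2 _ _ _ hxy ex ey
    obtain ⟨rfl, rfl⟩ | ⟨rfl, rfl⟩ : (x = c ∧ y = d) ∨ (x = d ∧ y = c) := by
      grind
    · rw [vc] at ex; rw [vd] at ey; cases ex; cases ey
      exact absurd hxy (key rfl)
    · rw [vd] at ex; rw [vc] at ey; cases ex; cases ey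
      exact absurd hxy.symm (key rfl)

end Commute

/-- Distinct switches of one tableau commute. -/
theorem Switch.diamond {T A B : MixedTableau} (hA : Switch T A) (hB : Switch T B) :
    A = B ∨ ∃ C, Switch A C ∧ Switch B C := by
  obtain ⟨ha, hb, c, c', h, ⟨r, hc⟩, ⟨s, hc'⟩, rfl, haA, hbA⟩ := hA
  obtain ⟨-, -, d, d', h', ⟨r', hd⟩, ⟨s', hd'⟩, rfl, haB, hbB⟩ := hB
  have h2 : c ≠ d' := by rintro rfl; simp [hc] at hd'
  have h3 : c' ≠ d := by rintro rfl; simp [hd] at hc'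
  by_cases h1 : c = d
  · subst h1
    rw [switch_target_unique h h' hc' hd' hbA hbB]
    exact .inl rfl
  by_cases h4 : c' = d'
  · subst h4
    exact absurd (switch_source_unique h h' hc hd haA haB) h1
  have hα := alphaColumnStrict_swap_swap h1 h2 h3 h4 hc hc' hd hd' h h' ha haA haB
  have hβ := betaRowStrict_swap_swap h1 h2 h3 h4 hc hc' hd hd' h h' hb hbA hbB
  refine .inr ⟨_, ⟨haA, hbA, d, d', h', ⟨r', ?_⟩, ⟨s', ?_⟩, rfl, hα, hβ⟩,
    ⟨haB, hbB, c, c', h, ⟨r, ?_⟩, ⟨s, ?_⟩, swapCells_comm h1 h2 h3 h4, hα, hβ⟩⟩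
  · rw [swapCells_of_ne _ (Ne.symm h1) (Ne.symm h3), hd]
  · rw [swapCells_of_ne _ (Ne.symm h2) (Ne.symm h4), hd']
  · rw [swapCells_of_ne _ h1 h2, hc]
  · rw [swapCells_of_ne _ h3 h4, hc']

theorem FullySwitched.eq_of_reflTransGen {X Y : MixedTableau} (hX : FullySwitched X)
    (h : Relation.ReflTransGen Switch X Y) : X = Y := by
  rcases h.cases_head with h | ⟨Z, hZ, -⟩
  · exact h
  · exact absurd ⟨Z, hZ⟩ hX

/-- The fully switched tableau reached from `T` is unique. -/
theorem fullySwitched_unique {T X Y : MixedTableau}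
    (hX : Relation.ReflTransGen Switch T X) (fX : FullySwitched X)
    (hY : Relation.ReflTransGen Switch T Y) (fY : FullySwitched Y) : X = Y := by
  obtain ⟨Z, h1, h2⟩ := Relation.church_rosser (r := Switch) (fun T A B hA hB => by
    rcases Switch.diamond hA hB with rfl | ⟨C, h1, h2⟩
    · exact ⟨A, .refl, .refl⟩
    · exact ⟨C, .single h1, .single h2⟩) hX hY
  rw [fX.eq_of_reflTransGen h1, fY.eq_of_reflTransGen h2]

/-! ### Termination -/

/-- The total height `i + j` of the `β`-cells in `F`. -/
noncomputable def betaHeight (F : Finset Cell) (T : MixedTableau) : ℕ :=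
  ∑ c ∈ F, if isBetaCell T c then c.1 + c.2 else 0

theorem mshape_swapCells {T : MixedTableau} {c c' : Cell} (hc : T c ≠ none) (hc' : T c' ≠ none) :
    mshape (swapCells T c c') = mshape T := by
  ext x
  simp only [mshape, Set.mem_ofPred_eq]
  by_cases h : x = c
  · subst h; simp [swapCells_left, hc, hc']
  by_cases h' : x = c'
  · subst h'; simp [swapCells_right, hc, hc']
  · rw [swapCells_of_ne _ h h']

theorem Switch.mshape_eq {T T' : MixedTableau} (h : Switch T T') : mshape T' = mshape T := by
  obtain ⟨-, -, c, c', -, ⟨r, hc⟩, ⟨s, hc'⟩, rfl, -, -⟩ := h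
  exact mshape_swapCells (by simp [hc]) (by simp [hc'])

theorem Switch.betaHeight_lt {F : Finset Cell} {T T' : MixedTableau} (h : Switch T T')
    (hF : mshape T ⊆ F) : betaHeight F T' < betaHeight F T := by
  obtain ⟨-, -, c, c', h, ⟨r, hc⟩, ⟨s, hc'⟩, rfl, -, -⟩ := h
  have mc : c ∈ F := hF (by simp [mshape, hc])
  have mc' : c' ∈ F := hF (by simp [mshape, hc'])
  have hne : c ≠ c' := by rintro rfl; simp [hc] at hc'
  have hlt : c.1 + c.2 < c'.1 + c'.2 := by
    rcases h with rfl | rfl <;> grind [rtCell, upCell]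
  have hrest : ∀ x ∈ (F.erase c).erase c',
      (if isBetaCell (swapCells T c c') x then x.1 + x.2 else 0)
        = if isBetaCell T x then x.1 + x.2 else 0 := by
    intro x hx
    simp only [Finset.mem_erase] at hx
    exact if_congr (by simp only [isBetaCell, swapCells_of_ne T hx.2.1 hx.1]) rfl rfl
  have m : c' ∈ F.erase c := Finset.mem_erase.2 ⟨hne.symm, mc'⟩
  unfold betaHeight
  rw [← Finset.add_sum_erase _ _ mc, ← Finset.add_sum_erase _ _ m,
    ← Finset.add_sum_erase F _ mc, ← Finset.add_sum_erase (F.erase c) _ m,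
    Finset.sum_congr rfl hrest]
  simp [isBetaCell, swapCells_left, swapCells_right, hc, hc']
  omega

/-! ### Switching one diagonal of pairs at a time -/

/-- The level of an entry when `α_r` and `β_{r+N}` are tied. -/
def MEntry.level (N : ℤ) : MEntry → ℤ
  | .al r => -r
  | .be s => N - s

/-- The filling of a tableau by levels. -/
def levels (N : ℤ) (T : MixedTableau) : Cell → Option ℤ := fun c => (T c).map (MEntry.level N)

/-- A filling of a convex set of cells that weakly increases to the northeast and
has no constant `2 × 2` square. -/
structure IsRibbonFilling (L : Cell → Option ℤ) : Prop where
  convex : ∀ c d e, c ≤ d → d ≤ e → L c ≠ none → L e ≠ none → L d ≠ none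
  mono : ∀ c c' x y, c ≤ c' → L c = some x → L c' = some y → x ≤ y
  square : ∀ i j x, L (i, j) = some x → L (i + 1, j + 1) ≠ some x

theorem level_between {L : Cell → Option ℤ}
    (convex : ∀ c d e, c ≤ d → d ≤ e → L c ≠ none → L e ≠ none → L d ≠ none)
    (mono : ∀ c c' x y, c ≤ c' → L c = some x → L c' = some y → x ≤ y)
    {c d e : Cell} {x : ℤ} (h : c ≤ d) (h' : d ≤ e)
    (hc : L c = some x) (he : L e = some x) : L d = some x := by
  obtain ⟨y, hy⟩ := Option.ne_none_iff_exists'.1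
    (convex c d e h h' (by simp [hc]) (by simp [he]))
  rw [hy, le_antisymm (mono _ _ _ _ h' hy he) (mono _ _ _ _ h hc hy)]

theorem IsRibbonFilling.between {L : Cell → Option ℤ} (hL : IsRibbonFilling L)
    {c d e : Cell} {x : ℤ} (h : c ≤ d) (h' : d ≤ e)
    (hc : L c = some x) (he : L e = some x) : L d = some x :=
  level_between hL.convex hL.mono h h' hc he

theorem IsRibbonFilling.not_lt {L : Cell → Option ℤ} (hL : IsRibbonFilling L)
    {c e : Cell} {x : ℤ} (h : c.1 < e.1) (h' : c.2 < e.2)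
    (hc : L c = some x) : L e ≠ some x := by
  intro he
  exact hL.square c.1 c.2 x hc
    (hL.between (d := (c.1 + 1, c.2 + 1)) ⟨by simp, by simp⟩ ⟨h, h'⟩ hc he)

theorem levels_al {N r : ℤ} {T : MixedTableau} {c : Cell} (h : T c = some (.al r)) :
    levels N T c = some (-r) := by simp [levels, h, MEntry.level]

theorem levels_be {N r : ℤ} {T : MixedTableau} {c : Cell} (h : T c = some (.be (r + N))) :
    levels N T c = some (-r) := by simp [levels, h, MEntry.level]

theorem eq_of_levels {N r : ℤ} {T : MixedTableau} {c : Cell} (h : levels N T c = some (-r)) :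
    T c = some (.al r) ∨ T c = some (.be (r + N)) := by
  simp only [levels, Option.map_eq_some_iff] at h
  obtain ⟨k | k, hk, e⟩ := h <;> simp only [MEntry.level] at e
  · left; rw [hk]; congr; omega
  · right; rw [hk]; congr; omega

theorem levels_swapCells {N r : ℤ} {T : MixedTableau} {c c' : Cell}
    (hc : T c = some (.al r)) (hc' : T c' = some (.be (r + N))) :
    levels N (swapCells T c c') = levels N T := by
  funext x
  by_cases h : x = c
  · subst h
    rw [levels_al hc]; exact levels_be (by rw [swapCells_left, hc'])
  by_cases h' : x = c'
  · subst h'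
    rw [levels_be hc']; exact levels_al (by rw [swapCells_right, hc])
  · simp only [levels, swapCells_of_ne _ h h']

theorem alphaColumnStrict_of_levels {N : ℤ} {T : MixedTableau}
    (hL : IsRibbonFilling (levels N T))
    (h : ∀ c c' r, c.2 = c'.2 → T c = some (.al r) → T c' = some (.al r) → c = c') :
    AlphaColumnStrict T := by
  refine alphaColumnStrict_iff.2 ⟨fun c c' r r' hc e e' => ?_, h⟩
  have := hL.mono _ _ _ _ hc (levels_al e) (levels_al e')
  omega

theorem betaRowStrict_of_levels {N : ℤ} {T : MixedTableau}
    (hL : IsRibbonFilling (levels N T))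
    (h : ∀ c c' r, c.1 = c'.1 → T c = some (.be r) → T c' = some (.be r) → c = c') :
    BetaRowStrict T := by
  refine betaRowStrict_iff.2 ⟨fun c c' r r' hc e e' => ?_, h⟩
  have := hL.mono _ _ (N - r) (N - r') hc (by simp [levels, e, MEntry.level])
    (by simp [levels, e', MEntry.level])
  omega

/-- Swapping an `α_r` with a tied adjacent `β` is a switch as soon as it creates no repetition of
`α_r` in a column and of the `β` in a row. -/
theorem switch_of_tied {N r : ℤ} {T : MixedTableau} (ha : AlphaColumnStrict T)
    (hb : BetaRowStrict T) (hL : IsRibbonFilling (levels N T)) {c c' : Cell}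
    (h : c' = rtCell c ∨ c' = upCell c)
    (hc : T c = some (.al r)) (hc' : T c' = some (.be (r + N)))
    (hα : ∀ d, d ≠ c → d.2 = c'.2 → T d ≠ some (.al r))
    (hβ : ∀ d, d ≠ c' → d.1 = c.1 → T d ≠ some (.be (r + N))) :
    Switch T (swapCells T c c') := by
  have hne : c ≠ c' := by rintro rfl; simp [hc] at hc'
  have hL' : IsRibbonFilling (levels N (swapCells T c c')) := by
    rwa [levels_swapCells hc hc']
  refine ⟨ha, hb, c, c', h, ⟨r, hc⟩, ⟨_, hc'⟩, rfl,
    alphaColumnStrict_of_levels hL' ?_, betaRowStrict_of_levels hL' ?_⟩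
  · have aux : ∀ y k, y ≠ c' → c'.2 = y.2 → swapCells T c c' c' = some (.al k) →
        swapCells T c c' y ≠ some (.al k) := by
      intro y k hy hcol e e'
      rw [swapCells_right, hc] at e
      cases e
      by_cases hyc : y = c
      · rw [hyc, swapCells_left, hc'] at e'; simp at e'
      · rw [swapCells_of_ne _ hyc hy] at e'
        exact hα y hyc hcol.symm e'
    intro x y k hxy ex ey
    by_contra hn
    by_cases hx : x = c'
    · subst hx; exact aux y k (Ne.symm hn) hxy ex ey
    by_cases hy : y = c'
    · subst hy; exact aux x k hn hxy.symm ey ex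
    have hxc : x ≠ c := by rintro rfl; rw [swapCells_left, hc'] at ex; simp at ex
    have hyc : y ≠ c := by rintro rfl; rw [swapCells_left, hc'] at ey; simp at ey
    rw [swapCells_of_ne _ hxc hx] at ex
    rw [swapCells_of_ne _ hyc hy] at ey
    exact hn ((alphaColumnStrict_iff.1 ha).2 _ _ _ hxy ex ey)
  · have aux : ∀ y k, y ≠ c → c.1 = y.1 → swapCells T c c' c = some (.be k) →
        swapCells T c c' y ≠ some (.be k) := by
      intro y k hy hrow e e'
      rw [swapCells_left, hc'] at e
      cases e
      by_cases hyc : y = c'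
      · rw [hyc, swapCells_right, hc] at e'; simp at e'
      · rw [swapCells_of_ne _ hy hyc] at e'
        exact hβ y hyc hrow.symm e'
    intro x y k hxy ex ey
    by_contra hn
    by_cases hx : x = c
    · subst hx; exact aux y k (Ne.symm hn) hxy ex ey
    by_cases hy : y = c
    · subst hy; exact aux x k hn hxy.symm ey ex
    have hxc : x ≠ c' := by rintro rfl; rw [swapCells_right, hc] at ex; simp at ex
    have hyc : y ≠ c' := by rintro rfl; rw [swapCells_right, hc] at ey; simp at ey
    rw [swapCells_of_ne _ hx hxc] at ex
    rw [swapCells_of_ne _ hy hyc] at ey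
    exact hn ((betaRowStrict_iff.1 hb).2 _ _ _ hxy ex ey)

/-- If some `α_r` lies weakly southwest of a tied `β`, then a switch of a tied pair is possible. -/
theorem exists_tied_switch {N r : ℤ} {T : MixedTableau} (ha : AlphaColumnStrict T)
    (hb : BetaRowStrict T) (hfin : (mshape T).Finite) (hL : IsRibbonFilling (levels N T))
    {a b : Cell} (hab : a ≤ b) (hca : T a = some (.al r)) (hcb : T b = some (.be (r + N))) :
    ∃ T', Switch T T' ∧ levels N T' = levels N T := by
  let S : Set Cell := {c | T c = some (.al r) ∧ ∃ c', c ≤ c' ∧ T c' = some (.be (r + N))}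
  have hS : S.Finite := hfin.subset fun c hc => by simp [mshape, hc.1]
  obtain ⟨c, ⟨hc, c₁, hcc₁, hc₁⟩, hmax⟩ :=
    hS.exists_maximalFor (fun c : Cell => (c.2 : ℤ) - c.1) S ⟨a, hca, b, hab, hcb⟩
  replace hmax : ∀ d d' : Cell, T d = some (.al r) → d ≤ d' → T d' = some (.be (r + N)) →
      (d.2 : ℤ) - d.1 ≤ (c.2 : ℤ) - c.1 := by
    intro d d' hd hdd' hd'
    by_contra hlt
    exact hlt (hmax (j := d) ⟨hd, d', hdd', hd'⟩ (by dsimp only; omega))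
  have hrow := (betaRowStrict_iff.1 hb).2
  have hcol := (alphaColumnStrict_iff.1 ha).2
  by_cases hex : ∃ d, d.1 = c.1 ∧ c ≤ d ∧ T d = some (.be (r + N))
  · obtain ⟨d, hd1, hcd, hd⟩ := hex
    have hlt : c.2 < d.2 := by
      refine lt_of_le_of_ne hcd.2 fun e => ?_
      rw [show d = c from Prod.ext hd1 e.symm, hc] at hd
      simp at hd
    have hle : rtCell c ≤ d := ⟨hcd.1, hlt⟩
    have hrt : T (rtCell c) = some (.be (r + N)) := by
      rcases eq_of_levels (hL.between (le_of_adjacent (.inl rfl)) hle (levels_al hc)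
        (levels_be hd)) with h | h
      · have := hmax _ _ h hle hd
        simp only [rtCell] at this; push_cast at this; omega
      · exact h
    refine ⟨_, switch_of_tied ha hb hL (.inl rfl) hc hrt ?_ ?_, levels_swapCells hc hrt⟩
    · intro k hkc hk2 hk
      simp only [rtCell] at hk2
      rcases le_or_gt k.1 c.1 with h | h
      · have := hmax k (rtCell c) hk ⟨h, hk2.le⟩ hrt
        omega
      · exact hL.not_lt h (by omega) (levels_al hc) (levels_al hk)
    · intro k hk hk1 e
      exact hk (hrow _ _ _ hk1 e hrt)
  · have hlt : c.1 < c₁.1 := by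
      refine lt_of_le_of_ne hcc₁.1 fun e => hex ⟨c₁, e.symm, hcc₁, hc₁⟩
    have hle : upCell c ≤ c₁ := ⟨hlt, hcc₁.2⟩
    have hup : T (upCell c) = some (.be (r + N)) := by
      rcases eq_of_levels (hL.between (le_of_adjacent (.inr rfl)) hle (levels_al hc)
        (levels_be hc₁)) with h | h
      · have := hcol (upCell c) c _ rfl h hc
        simp [upCell, Prod.ext_iff] at this
      · exact h
    refine ⟨_, switch_of_tied ha hb hL (.inr rfl) hc hup ?_ ?_, levels_swapCells hc hup⟩
    · intro k hk hk2 e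
      exact hk (hcol _ _ _ hk2 e hc)
    · intro k _ hk1 hk
      rcases le_or_gt c.2 k.2 with h | h
      · exact hex ⟨k, hk1, ⟨hk1.ge, h⟩, hk⟩
      · exact hL.not_lt (e := upCell c) (by simp only [upCell]; omega) h (levels_be hk)
          (levels_be hup)

/-- Among comparable cells, `α_r` precedes `β_s` exactly when `s - r ≤ N`. -/
def SortedAt (N : ℤ) (T : MixedTableau) : Prop :=
  (∀ c c' r s, c ≤ c' → T c = some (.al r) → T c' = some (.be s) → s - r ≤ N) ∧
  (∀ c c' r s, c ≤ c' → T c = some (.be s) → T c' = some (.al r) → N < s - r)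

theorem SortedAt.isRibbonFilling {N : ℤ} {T : MixedTableau} (ha : AlphaColumnStrict T)
    (hb : BetaRowStrict T) (hconv : (mshape T).OrdConnected) (hs : SortedAt N T) :
    IsRibbonFilling (levels N T) := by
  rw [alphaColumnStrict_iff] at ha
  rw [betaRowStrict_iff] at hb
  have convex : ∀ c d e, c ≤ d → d ≤ e → levels N T c ≠ none → levels N T e ≠ none →
      levels N T d ≠ none := by
    intro c d e h h' hc he
    simp only [levels, ne_eq, Option.map_eq_none_iff] at *
    exact hconv.out hc he ⟨h, h'⟩
  have mono : ∀ c c' x y, c ≤ c' → levels N T c = some x → levels N T c' = some y → x ≤ y := by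
    intro c c' x y h hc hc'
    simp only [levels, Option.map_eq_some_iff] at hc hc'
    obtain ⟨k | k, hk, rfl⟩ := hc <;> obtain ⟨l | l, hl, rfl⟩ := hc' <;>
      simp only [MEntry.level]
    · have := ha.1 _ _ _ _ h hk hl; omega
    · have := hs.1 _ _ _ _ h hk hl; omega
    · have := hs.2 _ _ _ _ h hk hl; omega
    · have := hb.1 _ _ _ _ h hk hl; omega
  refine ⟨convex, mono, fun i j x h00 h11 => ?_⟩
  obtain ⟨r, rfl⟩ : ∃ r, x = -r := ⟨-x, by simp⟩
  have l01 : ((i, j) : Cell) ≤ (i, j + 1) := ⟨le_rfl, by simp⟩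
  have l10 : ((i, j) : Cell) ≤ (i + 1, j) := ⟨by simp, le_rfl⟩
  have g01 : ((i, j + 1) : Cell) ≤ (i + 1, j + 1) := ⟨by simp, le_rfl⟩
  have g10 : ((i + 1, j) : Cell) ≤ (i + 1, j + 1) := ⟨le_rfl, by simp⟩
  have h01 := eq_of_levels (level_between convex mono l01 g01 h00 h11)
  have h10 := eq_of_levels (level_between convex mono l10 g10 h00 h11)
  have no_be_al : ∀ c c' : Cell, c ≤ c' → T c = some (.be (r + N)) → T c' ≠ some (.al r) := by
    intro c c' h e e'
    have := hs.2 _ _ _ _ h e e'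
    omega
  rcases eq_of_levels h00 with e | e
  · have e10 : T (i + 1, j) = some (.be (r + N)) := h10.resolve_left fun e' => by
      simpa using ha.2 (i, j) (i + 1, j) _ rfl e e'
    rcases eq_of_levels h11 with e' | e'
    · exact no_be_al _ _ g10 e10 e'
    · simpa using hb.2 (i + 1, j) (i + 1, j + 1) _ rfl e10 e'
  · rcases h01 with e' | e'
    · exact no_be_al _ _ l01 e e'
    · have := hb.2 (i, j) (i, j + 1) _ rfl e e'
      simp at this

/-- Switching all tied pairs moves the threshold down by one. -/
theorem exists_switch_sortedAt_pred {N : ℤ} {T : MixedTableau} (ha : AlphaColumnStrict T)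
    (hb : BetaRowStrict T) (hfin : (mshape T).Finite) (hL : IsRibbonFilling (levels N T)) :
    ∃ Y, Relation.ReflTransGen Switch T Y ∧ SortedAt (N - 1) Y := by
  induction hn : betaHeight hfin.toFinset T using Nat.strong_induction_on generalizing T with
  | _ n ih =>
  by_cases hex : ∃ a b r, a ≤ b ∧ T a = some (.al r) ∧ T b = some (.be (r + N))
  · obtain ⟨a, b, r, hab, hca, hcb⟩ := hex
    obtain ⟨T', hT', hlev⟩ := exists_tied_switch ha hb hfin hL hab hca hcb
    have hsh := hT'.mshape_eq
    have hfin' : (mshape T').Finite := by rwa [hsh]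
    have hF : hfin'.toFinset = hfin.toFinset := by simp [hsh]
    have ha' : AlphaColumnStrict T' := by
      obtain ⟨-, -, -, -, -, -, -, -, h, -⟩ := hT'; exact h
    have hb' : BetaRowStrict T' := by
      obtain ⟨-, -, -, -, -, -, -, -, -, h⟩ := hT'; exact h
    obtain ⟨Y, hY, hs⟩ := ih _ (by
      rw [← hn, hF]; exact hT'.betaHeight_lt (by simp)) ha' hb' hfin' (by rwa [hlev]) rfl
    exact ⟨Y, .head hT' hY, hs⟩
  · refine ⟨T, .refl, fun c c' r s h hc hc' => ?_, fun c c' r s h hc hc' => ?_⟩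
    · have hle := hL.mono _ _ (-r) (N - s) h (levels_al hc) (by simp [levels, hc', MEntry.level])
      have hne : s ≠ r + N := by
        rintro rfl; exact hex ⟨c, c', r, h, hc, hc'⟩
      omega
    · have hle := hL.mono _ _ (N - s) (-r) h (by simp [levels, hc, MEntry.level]) (levels_al hc')
      omega

/-- The properties of a tableau that switches preserve. -/
theorem switch_invariants {T Y : MixedTableau} (h : Relation.ReflTransGen Switch T Y)
    (ha : AlphaColumnStrict T) (hb : BetaRowStrict T) :
    AlphaColumnStrict Y ∧ BetaRowStrict Y ∧ mshape Y = mshape T ∧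
      ∀ c, ∃ d, Y c = T d := by
  induction h with
  | refl => exact ⟨ha, hb, rfl, fun c => ⟨c, rfl⟩⟩
  | tail _ h ih =>
    have hsh := h.mshape_eq
    obtain ⟨-, -, c, c', -, -, -, rfl, ha', hb'⟩ := h
    refine ⟨ha', hb', hsh.trans ih.2.2.1, fun x => ?_⟩
    rw [swapCells_apply]
    exact ih.2.2.2 _

/-- Repeated switching lowers the threshold arbitrarily far. -/
theorem exists_switch_sortedAt {N : ℤ} {T : MixedTableau} (ha : AlphaColumnStrict T)
    (hb : BetaRowStrict T) (hfin : (mshape T).Finite) (hconv : (mshape T).OrdConnected)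
    (hs : SortedAt N T) (n : ℕ) :
    ∃ Y, Relation.ReflTransGen Switch T Y ∧ SortedAt (N - n) Y := by
  induction n with
  | zero => exact ⟨T, .refl, by simpa using hs⟩
  | succ n ih =>
    obtain ⟨Y, hY, hsY⟩ := ih
    obtain ⟨haY, hbY, hsh, -⟩ := switch_invariants hY ha hb
    rw [← hsh] at hfin hconv
    obtain ⟨Z, hZ, hsZ⟩ := exists_switch_sortedAt_pred haY hbY hfin
      (hsY.isRibbonFilling haY hbY hconv)
    refine ⟨Z, hY.trans hZ, ?_⟩
    rwa [show N - (n + 1 : ℕ) = N - n - 1 by push_cast; ring]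

theorem HasSkewShape.ordConnected {T : MixedTableau} {lam mu : Set Cell}
    (h : HasSkewShape T lam mu) : (mshape T).OrdConnected := by
  obtain ⟨hl, hm, -, hsh⟩ := h
  rw [hsh]
  refine ⟨fun c hc e he d hd => ?_⟩
  have h1 := hm.2.1 c hc.1
  have h2 := hd.1
  have h3 := hd.2
  simp only [Prod.le_def] at h2 h3
  exact ⟨hm.2.2 e.1 e.2 d.1 d.2 he.1 (by omega) h3.1 (by omega) h3.2,
    fun hdl => hc.2 (hl.2.2 d.1 d.2 c.1 c.2 hdl h1.1 h2.1 h1.2 h2.2)⟩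

/-- A tableau of skew shape in which no `α` lies weakly southwest of a `β` is sorted. -/
theorem HasSkewShape.baSorted {T : MixedTableau} {lam mu : Set Cell} (h : HasSkewShape T lam mu)
    (hs : ∀ c c' r s, c ≤ c' → T c = some (.al r) → T c' ≠ some (.be s)) : BASorted T := by
  obtain ⟨hl, hm, hlm, hsh⟩ := h
  have mem : ∀ c, T c ≠ none ↔ c ∈ mu ∧ c ∉ lam := fun c => Set.ext_iff.1 hsh c
  have hβ : betaCells T ⊆ mu \ lam := by
    rintro c ⟨k, hk⟩; exact (mem c).1 (by simp [hk])
  have hnu : lam ∪ betaCells T ⊆ mu := Set.union_subset hlm fun c hc => (hβ hc).1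
  refine ⟨lam, mu, ⟨hl, hm, hlm, hsh⟩, lam ∪ betaCells T,
    ⟨hm.1.subset hnu, fun c hc => hm.2.1 c (hnu hc), ?_⟩, Set.subset_union_left, hnu, ?_, ?_⟩
  · rintro i j i' j' (h | ⟨s, h⟩) h1 h2 h3 h4
    · exact .inl (hl.2.2 i j i' j' h h1 h2 h3 h4)
    · by_cases hlam : (i', j') ∈ lam
      · exact .inl hlam
      · have := hm.2.2 i j i' j' (hβ ⟨s, h⟩).1 h1 h2 h3 h4
        obtain ⟨r | r, e⟩ := Option.ne_none_iff_exists'.1 ((mem _).2 ⟨this, hlam⟩)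
        · exact absurd h (hs _ _ r s ⟨h2, h4⟩ e)
        · exact .inr ⟨r, e⟩
  · ext c
    exact ⟨fun hc => ⟨.inr hc, (hβ hc).2⟩, fun hc => hc.1.resolve_left hc.2⟩
  · ext c
    constructor
    · rintro ⟨k, hk⟩
      have := (mem c).1 (by simp [hk])
      refine ⟨this.1, ?_⟩
      rintro (h | ⟨l, hl'⟩)
      · exact this.2 h
      · simp [hk] at hl'
    · rintro ⟨h1, h2⟩
      obtain ⟨r | r, e⟩ := Option.ne_none_iff_exists'.1 ((mem c).2 ⟨h1, fun h => h2 (.inl h)⟩)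
      · exact ⟨r, e⟩
      · exact absurd (.inr ⟨r, e⟩) h2

theorem ABSortedShape.not_be_le_al {T : MixedTableau} {lam mu : Set Cell}
    (hmu : IsPartitionShape mu) (h : ABSortedShape T lam mu) {c c' : Cell} {r s : ℤ}
    (hcc' : c ≤ c') (hc : T c = some (.be s)) : T c' ≠ some (.al r) := by
  intro hc'
  obtain ⟨nu, hnu, -, -, hα, hβ⟩ := h
  have h1 : c ∈ mu \ nu := hβ ▸ ⟨s, hc⟩
  have h2 : c' ∈ nu \ lam := hα ▸ ⟨r, hc'⟩
  have h3 := hmu.2.1 c h1.1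
  obtain ⟨hle₁, hle₂⟩ := hcc'
  exact h1.2 (hnu.2.2 c'.1 c'.2 c.1 c.2 h2.1 h3.1 hle₁ h3.2 hle₂)

/-- Some sequence of switches leads to a `(β,α)`-sorted fully switched tableau. -/
theorem exists_fullySwitched_baSorted {T : MixedTableau} (hfin : (mshape T).Finite)
    (ha : AlphaColumnStrict T) (hb : BetaRowStrict T) (hs : ABSorted T) :
    ∃ Y, Relation.ReflTransGen Switch T Y ∧ FullySwitched Y ∧
      AlphaColumnStrict Y ∧ BetaRowStrict Y ∧ BASorted Y := by
  obtain ⟨lam, mu, hskew, hAB⟩ := hs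
  obtain ⟨M, hM⟩ : ∃ M : ℕ, ∀ c e, T c = some e → |e.idx| ≤ M := by
    refine ⟨∑ c ∈ hfin.toFinset, ((T c).elim 0 fun e => e.idx.natAbs), fun c e he => ?_⟩
    have := Finset.single_le_sum (f := fun c => (T c).elim 0 fun e => e.idx.natAbs)
      (fun _ _ => Nat.zero_le _) (hfin.mem_toFinset.2 (show c ∈ mshape T by simp [mshape, he]))
    simp only [he, Option.elim_some] at this
    rw [Int.abs_eq_natAbs]
    exact_mod_cast this
  have hT : SortedAt (2 * M) T := by
    refine ⟨fun c c' r s _ hc hc' => ?_,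
      fun c c' r s h hc hc' => absurd hc' (hAB.not_be_le_al hskew.2.1 h hc)⟩
    have h1 := abs_le.1 (hM _ _ hc)
    have h2 := abs_le.1 (hM _ _ hc')
    simp only [MEntry.idx] at h1 h2
    omega
  obtain ⟨Y, hY, hsY⟩ := exists_switch_sortedAt ha hb hfin hskew.ordConnected hT (4 * M + 1)
  obtain ⟨haY, hbY, hsh, hent⟩ := switch_invariants hY ha hb
  have hno : ∀ c c' r s, c ≤ c' → Y c = some (.al r) → Y c' ≠ some (.be s) := by
    intro c c' r s h hc hc'
    have h0 := hsY.1 _ _ _ _ h hc hc'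
    obtain ⟨d, hd⟩ := hent c
    obtain ⟨d', hd'⟩ := hent c'
    have h1 := abs_le.1 (hM _ _ (hd ▸ hc))
    have h2 := abs_le.1 (hM _ _ (hd' ▸ hc'))
    simp only [MEntry.idx] at h1 h2
    push_cast at h0
    omega
  refine ⟨Y, hY, ?_, haY, hbY, ?_⟩
  · rintro ⟨Z, -, -, c, c', h, ⟨r, hc⟩, ⟨s, hc'⟩, -⟩
    exact hno _ _ r s (le_of_adjacent h) hc hc'
  · exact HasSkewShape.baSorted (lam := lam) (mu := mu)
      ⟨hskew.1, hskew.2.1, hskew.2.2.1, hsh.trans hskew.2.2.2⟩ hno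

/-- Theorem (Benkart–Sottile–Stroomer): applying switches to an
`α`-column-strict, `β`-row-strict, `(α,β)`-sorted mixed tableau until it is
fully switched yields an `α`-column-strict, `β`-row-strict, `(β,α)`-sorted
tableau, independent of the sequence of switches. -/
theorem tableau_switching (T : MixedTableau)
    (hT : IsMixedTableau T) (ha : AlphaColumnStrict T) (hb : BetaRowStrict T)
    (hs : ABSorted T) :
    (∃ X, Relation.ReflTransGen Switch T X ∧ FullySwitched X) ∧
    (∀ X, Relation.ReflTransGen Switch T X → FullySwitched X →
      AlphaColumnStrict X ∧ BetaRowStrict X ∧ BASorted X) ∧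
    (∀ X X', Relation.ReflTransGen Switch T X → FullySwitched X →
      Relation.ReflTransGen Switch T X' → FullySwitched X' → X = X') := by
  obtain ⟨Y, hY, fY, h⟩ := exists_fullySwitched_baSorted hT.1 ha hb hs
  refine ⟨⟨Y, hY, fY⟩, fun X hX fX => ?_, fun X X' hX fX hX' fX' =>
    fullySwitched_unique hX fX hX' fX'⟩
  rwa [fullySwitched_unique hX fX hY fY]
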